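/- arXiv:1506.06961 — 7 statements merged into one kernel-verified Lean document; each statement's English description precedes it below -/
import Mathlib

section
/- For all natural numbers a, b, c with a ≤ b ≤ c, the Sprague–Grundy value satisfies G(a,b,c) = G(0, b−a, c−a). -/
namespace SharingNim

/-- The moves of three-pile Sharing Nim: take `k ≥ 1` tokens from one pile and add them to
another pile, provided the receiving pile has at most as many tokens as the source pile
after the move (i.e. `2 * k` is at most the difference of the two piles). -/
def moves : ℕ × ℕ × ℕ → Finset (ℕ × ℕ × ℕ)
  | (a, b, c) =>
    ((Finset.Icc 1 ((b - a) / 2)).image fun k => (a + k, b - k, c)) ∪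
    ((Finset.Icc 1 ((a - b) / 2)).image fun k => (a - k, b + k, c)) ∪
    ((Finset.Icc 1 ((c - a) / 2)).image fun k => (a + k, b, c - k)) ∪
    ((Finset.Icc 1 ((a - c) / 2)).image fun k => (a - k, b, c + k)) ∪
    ((Finset.Icc 1 ((c - b) / 2)).image fun k => (a, b + k, c - k)) ∪
    ((Finset.Icc 1 ((b - c) / 2)).image fun k => (a, b - k, c + k))

/-- The sum of squares of the pile sizes, a measure that strictly decreases along
every move. -/
def measure3 (p : ℕ × ℕ × ℕ) : ℕ := p.1 ^ 2 + p.2.1 ^ 2 + p.2.2 ^ 2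

theorem sq_move_lt {x y k : ℕ} (hk : 1 ≤ k) (h : k ≤ (y - x) / 2) :
    (x + k) ^ 2 + (y - k) ^ 2 < x ^ 2 + y ^ 2 := by
  have h1 : x + 2 * k ≤ y := by omega
  have h2 : k ≤ y := by omega
  zify [h2]
  nlinarith

theorem measure3_lt_of_mem_moves {q p : ℕ × ℕ × ℕ} (h : q ∈ moves p) :
    measure3 q < measure3 p := by
  obtain ⟨a, b, c⟩ := p
  simp only [moves, Finset.mem_union, Finset.mem_image, Finset.mem_Icc] at h
  rcases h with ((((⟨k, ⟨hk1, hk2⟩, rfl⟩ | ⟨k, ⟨hk1, hk2⟩, rfl⟩) | ⟨k, ⟨hk1, hk2⟩, rfl⟩) |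
      ⟨k, ⟨hk1, hk2⟩, rfl⟩) | ⟨k, ⟨hk1, hk2⟩, rfl⟩) | ⟨k, ⟨hk1, hk2⟩, rfl⟩ <;>
    simp only [measure3] <;>
    [linarith [sq_move_lt (x := a) (y := b) hk1 hk2];
     linarith [sq_move_lt (x := b) (y := a) hk1 hk2];
     linarith [sq_move_lt (x := a) (y := c) hk1 hk2];
     linarith [sq_move_lt (x := c) (y := a) hk1 hk2];
     linarith [sq_move_lt (x := b) (y := c) hk1 hk2];
     linarith [sq_move_lt (x := c) (y := b) hk1 hk2]]

/-- The minimum excludant of a finite set of naturals. -/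
noncomputable def mex (s : Finset ℕ) : ℕ := sInf {n : ℕ | n ∉ s}

/-- The Sprague–Grundy value of a position of three-pile Sharing Nim: the minimum
excludant of the Sprague–Grundy values of the positions reachable in one move. -/
noncomputable def G (p : ℕ × ℕ × ℕ) : ℕ :=
  mex ((moves p).attach.image fun q => G q.1)
termination_by measure3 p
decreasing_by exact measure3_lt_of_mem_moves q.2

theorem moves_shift (a b c t : ℕ) :
    moves (a + t, b + t, c + t) =
      (moves (a, b, c)).image fun q => (q.1 + t, q.2.1 + t, q.2.2 + t) := by
  simp only [moves, Finset.image_union, Finset.image_image, Nat.add_sub_add_right]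
  congr 1
  · congr 1
    · congr 1
      · congr 1
        · congr 1
          all_goals
            apply Finset.image_congr
            intro k hk
            simp only [Finset.coe_Icc, Set.mem_Icc] at hk
            change (_, _, _) = (_, _, _)
            simp only [Prod.mk.injEq, and_true, true_and]
            omega
        · apply Finset.image_congr
          intro k hk
          simp only [Finset.coe_Icc, Set.mem_Icc] at hk
          change (_, _, _) = (_, _, _)
          simp only [Prod.mk.injEq, and_true, true_and]
          omega
      · apply Finset.image_congr
        intro k hk
        simp only [Finset.coe_Icc, Set.mem_Icc] at hk
        change (_, _, _) = (_, _, _)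
        simp only [Prod.mk.injEq, and_true, true_and]
        omega
    · apply Finset.image_congr
      intro k hk
      simp only [Finset.coe_Icc, Set.mem_Icc] at hk
      change (_, _, _) = (_, _, _)
      simp only [Prod.mk.injEq, and_true, true_and]
      omega
  · apply Finset.image_congr
    intro k hk
    simp only [Finset.coe_Icc, Set.mem_Icc] at hk
    change (_, _, _) = (_, _, _)
    simp only [Prod.mk.injEq, and_true, true_and]
    omega

theorem G_eq (p : ℕ × ℕ × ℕ) : G p = mex ((moves p).image G) := by
  rw [G]
  congr 1
  ext n
  simp

theorem G_shift (t : ℕ) (p : ℕ × ℕ × ℕ) : G (p.1 + t, p.2.1 + t, p.2.2 + t) = G p := by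
  rw [G_eq, G_eq p, moves_shift, Finset.image_image]
  congr 1
  apply Finset.image_congr
  intro q hq
  exact G_shift t q
termination_by measure3 p
decreasing_by exact measure3_lt_of_mem_moves hq

/-- For all naturals `a ≤ b ≤ c`, `G(a,b,c) = G(0, b-a, c-a)`. -/
theorem grundy_sub_smallest (a b c : ℕ) (hab : a ≤ b) (hbc : b ≤ c) :
    G (a, b, c) = G (0, b - a, c - a) := by
  have h := G_shift a (0, b - a, c - a)
  simp only [Nat.zero_add, Nat.sub_add_cancel hab, Nat.sub_add_cancel (hab.trans hbc)] at h
  exact h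

end SharingNim
end

section
/- For all natural numbers a, b with a ≤ b, the Sprague–Grundy value satisfies G(0, a, b) = G(0, b−a, b). -/
namespace SharingNim

/-- Reflection of a position inside the box `[0, M]^3`. -/
def reflect (M : ℕ) (p : ℕ × ℕ × ℕ) : ℕ × ℕ × ℕ := (M - p.2.2, M - p.2.1, M - p.1)

/-- All piles are at most `M`. -/
def Bdd (M : ℕ) (p : ℕ × ℕ × ℕ) : Prop := p.1 ≤ M ∧ p.2.1 ≤ M ∧ p.2.2 ≤ M

theorem reflect_mem {M : ℕ} {p q : ℕ × ℕ × ℕ} (hp : Bdd M p) (h : q ∈ moves p) :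
    Bdd M q ∧ reflect M q ∈ moves (reflect M p) := by
  obtain ⟨a, b, c⟩ := p
  obtain ⟨h1, h2, h3⟩ := hp
  simp only at h1 h2 h3
  simp only [moves, Finset.mem_union, Finset.mem_image, Finset.mem_Icc] at h
  simp only [moves, reflect, Bdd, Finset.mem_union, Finset.mem_image, Finset.mem_Icc,
    Prod.mk.injEq]
  rcases h with ((((⟨k, ⟨hk1, hk2⟩, rfl⟩ | ⟨k, ⟨hk1, hk2⟩, rfl⟩) | ⟨k, ⟨hk1, hk2⟩, rfl⟩) |
      ⟨k, ⟨hk1, hk2⟩, rfl⟩) | ⟨k, ⟨hk1, hk2⟩, rfl⟩) | ⟨k, ⟨hk1, hk2⟩, rfl⟩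
  · exact ⟨by dsimp only; omega, Or.inl (Or.inr ⟨k, by omega, by dsimp only; omega⟩)⟩
  · exact ⟨by dsimp only; omega, Or.inr ⟨k, by omega, by dsimp only; omega⟩⟩
  · exact ⟨by dsimp only; omega, Or.inl (Or.inl (Or.inl (Or.inr ⟨k, by omega, by dsimp only; omega⟩)))⟩ 
  · exact ⟨by dsimp only; omega, Or.inl (Or.inl (Or.inr ⟨k, by omega, by dsimp only; omega⟩))⟩
  · exact ⟨by dsimp only; omega, Or.inl (Or.inl (Or.inl (Or.inl (Or.inl ⟨k, by omega, by dsimp only; omega⟩))))⟩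
  · exact ⟨by dsimp only; omega, Or.inl (Or.inl (Or.inl (Or.inl (Or.inr ⟨k, by omega, by dsimp only; omega⟩))))⟩

theorem reflect_reflect {M : ℕ} {p : ℕ × ℕ × ℕ} (hp : Bdd M p) :
    reflect M (reflect M p) = p := by
  obtain ⟨a, b, c⟩ := p
  obtain ⟨h1, h2, h3⟩ := hp
  simp only at h1 h2 h3
  simp only [reflect, Prod.mk.injEq]
  omega

theorem bdd_reflect (M : ℕ) (p : ℕ × ℕ × ℕ) : Bdd M (reflect M p) :=
  ⟨Nat.sub_le _ _, Nat.sub_le _ _, Nat.sub_le _ _⟩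

theorem G_reflect (M : ℕ) : ∀ (n : ℕ) (p : ℕ × ℕ × ℕ), measure3 p = n → Bdd M p →
    G (reflect M p) = G p := by
  intro n
  induction n using Nat.strong_induction_on with
  | _ n ih =>
    intro p hn hp
    rw [G_eq, G_eq p]
    congr 1
    ext v
    simp only [Finset.mem_image]
    constructor
    · rintro ⟨q, hq, rfl⟩
      obtain ⟨hb, hm⟩ := reflect_mem (bdd_reflect M p) hq
      rw [reflect_reflect hp] at hm
      refine ⟨_, hm, ?_⟩
      rw [← ih _ (hn ▸ measure3_lt_of_mem_moves hm) _ rfl (bdd_reflect M q), reflect_reflect hb]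
    · rintro ⟨q, hq, rfl⟩
      obtain ⟨hb, hm⟩ := reflect_mem hp hq
      exact ⟨_, hm, ih _ (hn ▸ measure3_lt_of_mem_moves hq) _ rfl hb⟩

/-- For all naturals `a ≤ b`, `G(0,a,b) = G(0, b-a, b)`. -/
theorem grundy_reflect (a b : ℕ) (hab : a ≤ b) :
    G (0, a, b) = G (0, b - a, b) := by
  have h := G_reflect b _ (0, a, b) rfl ⟨Nat.zero_le _, hab, le_refl _⟩
  simpa [reflect] using h.symm

end SharingNim
end

section
/- For all natural numbers a, b, i with 2a ≤ b and i ≤ b − 2a, the Sprague–Grundy value satisfies G(0, a+i, b) = G(0, b−a−i, b); that is, the finite sequence (G(0,a,b), G(0,a+1,b), …, G(0,b−a,b)) is a palindrome. -/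
namespace SharingNim

/-- Reflection of a position bounded by `s`. -/
def refl3 (s : ℕ) (p : ℕ × ℕ × ℕ) : ℕ × ℕ × ℕ := (s - p.2.2, s - p.2.1, s - p.1)

/-- All piles are at most `s`. -/
def bdd3 (s : ℕ) (p : ℕ × ℕ × ℕ) : Prop := p.1 ≤ s ∧ p.2.1 ≤ s ∧ p.2.2 ≤ s

theorem refl3_refl3 {s : ℕ} {p : ℕ × ℕ × ℕ} (h : bdd3 s p) : refl3 s (refl3 s p) = p := by
  obtain ⟨a, b, c⟩ := p
  simp only [bdd3] at h
  simp only [refl3, Prod.mk.injEq]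
  omega

theorem bdd3_refl3 (s : ℕ) (p : ℕ × ℕ × ℕ) : bdd3 s (refl3 s p) := by
  simp [bdd3, refl3]

theorem moves_refl3 {s : ℕ} {p q : ℕ × ℕ × ℕ} (h : bdd3 s p) (hq : q ∈ moves p) :
    bdd3 s q ∧ refl3 s q ∈ moves (refl3 s p) := by
  obtain ⟨a, b, c⟩ := p
  simp only [bdd3] at h
  simp only [moves, Finset.mem_union, Finset.mem_image, Finset.mem_Icc] at hq
  simp only [refl3, moves, Finset.mem_union, Finset.mem_image, Finset.mem_Icc, bdd3]
  rcases hq with ((((⟨k, hk, rfl⟩ | ⟨k, hk, rfl⟩) | ⟨k, hk, rfl⟩) |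
      ⟨k, hk, rfl⟩) | ⟨k, hk, rfl⟩) | ⟨k, hk, rfl⟩ <;>
    refine ⟨by simp only; omega, ?_⟩
  · refine Or.inl (Or.inr ⟨k, by omega, ?_⟩)
    refine Prod.ext ?_ (Prod.ext ?_ ?_) <;> dsimp only <;> omega
  · refine Or.inr ⟨k, by omega, ?_⟩
    refine Prod.ext ?_ (Prod.ext ?_ ?_) <;> dsimp only <;> omega
  · refine Or.inl (Or.inl (Or.inl (Or.inr ⟨k, by omega, ?_⟩)))
    refine Prod.ext ?_ (Prod.ext ?_ ?_) <;> dsimp only <;> omega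
  · refine Or.inl (Or.inl (Or.inr ⟨k, by omega, ?_⟩))
    refine Prod.ext ?_ (Prod.ext ?_ ?_) <;> dsimp only <;> omega
  · refine Or.inl (Or.inl (Or.inl (Or.inl (Or.inl ⟨k, by omega, ?_⟩))))
    refine Prod.ext ?_ (Prod.ext ?_ ?_) <;> dsimp only <;> omega
  · refine Or.inl (Or.inl (Or.inl (Or.inl (Or.inr ⟨k, by omega, ?_⟩))))
    refine Prod.ext ?_ (Prod.ext ?_ ?_) <;> dsimp only <;> omega

theorem G_refl3 (s : ℕ) (n : ℕ) : ∀ p : ℕ × ℕ × ℕ, measure3 p < n → bdd3 s p →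
    G p = G (refl3 s p) := by
  induction n with
  | zero => intro p h; omega
  | succ n ih =>
    intro p hn hp
    rw [G, G]
    congr 1
    ext v
    simp only [Finset.mem_image, Finset.mem_attach, true_and, Subtype.exists]
    constructor
    · rintro ⟨q, hq, rfl⟩
      have hm := measure3_lt_of_mem_moves hq
      obtain ⟨hb, hr⟩ := moves_refl3 hp hq
      exact ⟨refl3 s q, hr, (ih q (by omega) hb).symm⟩
    · rintro ⟨q, hq, rfl⟩
      obtain ⟨hb, hr⟩ := moves_refl3 (bdd3_refl3 s p) hq
      rw [refl3_refl3 hp] at hr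
      have hm := measure3_lt_of_mem_moves hr
      refine ⟨refl3 s q, hr, ?_⟩
      rw [ih _ (by omega) (bdd3_refl3 s q), refl3_refl3 hb]

/-- For `2a ≤ b` and `i ≤ b - 2a`, `G(0, a+i, b) = G(0, b-a-i, b)`;
the sequence `(G(0,a,b), G(0,a+1,b), …, G(0,b-a,b))` is a palindrome. -/
theorem grundy_palindrome (a b i : ℕ) (hab : 2 * a ≤ b) (hi : i ≤ b - 2 * a) :
    G (0, a + i, b) = G (0, b - a - i, b) := by
  have h := G_refl3 b _ (0, a + i, b) (Nat.lt_succ_self _) (by simp only [bdd3]; omega)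
  rw [h]
  simp [refl3, Nat.sub_sub]

end SharingNim
end

section
/- For all natural numbers a and i, the Sprague–Grundy value satisfies G(0, a, 2a+i) = G(0, a+i, 2a+i); that is, the sequences (G(0,a,2a+i))_{i ≥ 0} and (G(0,a+i,2a+i))_{i ≥ 0} are identical. -/
namespace SharingNim

/-- `p` and `q` are mirror images of each other: `q` is `p` negated, shifted by `N`, reversed. -/
def Mirror (N : ℕ) (p q : ℕ × ℕ × ℕ) : Prop :=
  p.1 + q.2.2 = N ∧ p.2.1 + q.2.1 = N ∧ p.2.2 + q.1 = N

theorem Mirror.symm {N : ℕ} {p q : ℕ × ℕ × ℕ} (h : Mirror N p q) : Mirror N q p := by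
  unfold Mirror at *
  omega

theorem Mirror.exists_move {N : ℕ} {p q p' : ℕ × ℕ × ℕ} (h : Mirror N p q)
    (hp : p' ∈ moves p) : ∃ q' ∈ moves q, Mirror N p' q' := by
  obtain ⟨a, b, c⟩ := p
  obtain ⟨d, e, f⟩ := q
  simp only [Mirror] at h
  obtain ⟨h1, h2, h3⟩ := h
  simp only [moves, Finset.mem_union, Finset.mem_image, Finset.mem_Icc] at hp
  rcases hp with ((((⟨k, ⟨hk1, hk2⟩, rfl⟩ | ⟨k, ⟨hk1, hk2⟩, rfl⟩) | ⟨k, ⟨hk1, hk2⟩, rfl⟩) |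
      ⟨k, ⟨hk1, hk2⟩, rfl⟩) | ⟨k, ⟨hk1, hk2⟩, rfl⟩) | ⟨k, ⟨hk1, hk2⟩, rfl⟩ <;>
    simp only [Mirror, moves, Finset.mem_union, Finset.mem_image, Finset.mem_Icc]
  · exact ⟨(d, e + k, f - k), Or.inl (Or.inr ⟨k, by omega, rfl⟩), by dsimp only; omega⟩
  · exact ⟨(d, e - k, f + k), Or.inr ⟨k, by omega, rfl⟩, by dsimp only; omega⟩
  · exact ⟨(d + k, e, f - k), Or.inl (Or.inl (Or.inl (Or.inr ⟨k, by omega, rfl⟩))),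
      by dsimp only; omega⟩
  · exact ⟨(d - k, e, f + k), Or.inl (Or.inl (Or.inr ⟨k, by omega, rfl⟩)), by dsimp only; omega⟩
  · exact ⟨(d + k, e - k, f), Or.inl (Or.inl (Or.inl (Or.inl (Or.inl ⟨k, by omega, rfl⟩)))),
      by dsimp only; omega⟩
  · exact ⟨(d - k, e + k, f), Or.inl (Or.inl (Or.inl (Or.inl (Or.inr ⟨k, by omega, rfl⟩)))),
      by dsimp only; omega⟩

theorem G_eq_of_mirror {N : ℕ} (n : ℕ) : ∀ p q : ℕ × ℕ × ℕ, measure3 p = n →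
    Mirror N p q → G p = G q := by
  induction n using Nat.strong_induction_on with
  | _ n ih =>
    intro p q hn h
    rw [G, G]
    congr 1
    ext v
    simp only [Finset.mem_image, Finset.mem_attach, true_and, Subtype.exists]
    constructor
    · rintro ⟨p', hp', rfl⟩
      obtain ⟨q', hq', hm⟩ := h.exists_move hp'
      exact ⟨q', hq', (ih _ (hn ▸ measure3_lt_of_mem_moves hp') p' q' rfl hm).symm⟩
    · rintro ⟨q', hq', rfl⟩
      obtain ⟨p', hp', hm⟩ := h.symm.exists_move hq'
      exact ⟨p', hp', ih _ (hn ▸ measure3_lt_of_mem_moves hp') p' q' rfl hm.symm⟩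

/-- The sequences `(G(0,a,2a+i))_{i ≥ 0}` and `(G(0,a+i,2a+i))_{i ≥ 0}`
are identical. -/
theorem grundy_row_eq_diagonal (a i : ℕ) :
    G (0, a, 2 * a + i) = G (0, a + i, 2 * a + i) := by
  refine G_eq_of_mirror (N := 2 * a + i) _ _ _ rfl ?_
  simp only [Mirror]
  omega

end SharingNim
end

section
/- For all natural numbers a, b with a ≤ b, G(0, a, b) = 0 if and only if one of the following holds: (i) a = b = 0; (ii) a = 0, b > 0, and ν₂(b) is even; (iii) a = b > 0 and ν₂(b) is even. Equivalently, the P-positions of the form (0,a,b) are exactly (0,0,0), (0, 0, 2^{2k}(2l+1)) and (0, 2^{2k}(2l+1), 2^{2k}(2l+1)) for k, l ≥ 0. -/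
namespace SharingNim

/-- The 2-adic valuation is even (with the convention that this holds at zero). -/
def Ev (n : ℕ) : Prop := Even (padicValNat 2 n)

theorem ev_double {n : ℕ} (h : 0 < n) : Ev (2 * n) ↔ ¬ Ev n := by
  unfold Ev
  rw [padicValNat.mul (by norm_num) (by omega), padicValNat.self (by norm_num), add_comm,
    Nat.even_add_one]

theorem ev_odd {n : ℕ} (h : n % 2 = 1) : Ev n := by
  unfold Ev
  rw [padicValNat.eq_zero_of_not_dvd (by omega)]
  exact Even.zero

theorem ev_zero : Ev 0 := by simp [Ev]

/-- The candidate set of P-positions. -/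
def PP : ℕ × ℕ × ℕ → Prop
  | (a, b, c) =>
    (a = b ∧ Ev ((a - c) + (c - a))) ∨ (b = c ∧ Ev ((a - b) + (b - a))) ∨
      (a = c ∧ Ev ((a - b) + (b - a)))

theorem ev_contra {x y : ℕ} (hx : Ev x) (hy : Ev y) (h : 0 < x) (h2 : y = 2 * x) : False := by
  subst h2
  exact (ev_double h).1 hy hx

theorem PP_moves {p q : ℕ × ℕ × ℕ} (h : q ∈ moves p) (hp : PP p) : ¬ PP q := by
  obtain ⟨a, b, c⟩ := p
  intro hq
  simp only [moves, Finset.mem_union, Finset.mem_image, Finset.mem_Icc] at h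
  rcases h with ((((⟨k, ⟨hk1, hk2⟩, rfl⟩ | ⟨k, ⟨hk1, hk2⟩, rfl⟩) | ⟨k, ⟨hk1, hk2⟩, rfl⟩) |
      ⟨k, ⟨hk1, hk2⟩, rfl⟩) | ⟨k, ⟨hk1, hk2⟩, rfl⟩) | ⟨k, ⟨hk1, hk2⟩, rfl⟩ <;>
    rcases hp with ⟨h1, h2⟩ | ⟨h1, h2⟩ | ⟨h1, h2⟩ <;>
    rcases hq with ⟨h3, h4⟩ | ⟨h3, h4⟩ | ⟨h3, h4⟩ <;>
    first
    | omega
    | exact ev_contra h4 h2 (by omega) (by omega)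

theorem mem_moves {a b c x y z : ℕ} : (x, y, z) ∈ moves (a, b, c) ↔ ∃ k, 1 ≤ k ∧
    ((a + 2 * k ≤ b ∧ x = a + k ∧ y + k = b ∧ z = c) ∨
     (b + 2 * k ≤ a ∧ x + k = a ∧ y = b + k ∧ z = c) ∨
     (a + 2 * k ≤ c ∧ x = a + k ∧ y = b ∧ z + k = c) ∨
     (c + 2 * k ≤ a ∧ x + k = a ∧ y = b ∧ z = c + k) ∨
     (b + 2 * k ≤ c ∧ x = a ∧ y = b + k ∧ z + k = c) ∨
     (c + 2 * k ≤ b ∧ x = a ∧ y + k = b ∧ z = c + k)) := by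
  simp only [moves, Finset.mem_union, Finset.mem_image, Finset.mem_Icc, Prod.mk.injEq]
  constructor
  · rintro (((((⟨k, h, h'⟩ | ⟨k, h, h'⟩) | ⟨k, h, h'⟩) | ⟨k, h, h'⟩) | ⟨k, h, h'⟩) |
      ⟨k, h, h'⟩)
    · exact ⟨k, h.1, Or.inl ⟨by omega, by omega, by omega, by omega⟩⟩
    · exact ⟨k, h.1, Or.inr (Or.inl ⟨by omega, by omega, by omega, by omega⟩)⟩
    · exact ⟨k, h.1, Or.inr (Or.inr (Or.inl ⟨by omega, by omega, by omega, by omega⟩))⟩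
    · exact ⟨k, h.1, Or.inr (Or.inr (Or.inr (Or.inl ⟨by omega, by omega, by omega, by omega⟩)))⟩
    · exact ⟨k, h.1, Or.inr (Or.inr (Or.inr (Or.inr (Or.inl ⟨by omega, by omega, by omega, by omega⟩))))⟩
    · exact ⟨k, h.1, Or.inr (Or.inr (Or.inr (Or.inr (Or.inr (⟨by omega, by omega, by omega, by omega⟩)))))⟩
  · rintro ⟨k, h, h' | h' | h' | h' | h' | h'⟩
    · exact Or.inl (Or.inl (Or.inl (Or.inl (Or.inl ⟨k, by omega, by omega⟩))))
    · exact Or.inl (Or.inl (Or.inl (Or.inl (Or.inr ⟨k, by omega, by omega⟩))))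
    · exact Or.inl (Or.inl (Or.inl (Or.inr ⟨k, by omega, by omega⟩)))
    · exact Or.inl (Or.inl (Or.inr ⟨k, by omega, by omega⟩))
    · exact Or.inl (Or.inr ⟨k, by omega, by omega⟩)
    · exact Or.inr ⟨k, by omega, by omega⟩

/-- Some move leads to a candidate P-position. -/
def Win (a b c : ℕ) : Prop := ∃ x y z, (x, y, z) ∈ moves (a, b, c) ∧ PP (x, y, z)

theorem PP_swap12 {a b c : ℕ} (h : PP (a, b, c)) : PP (b, a, c) := by
  rcases h with ⟨h1, h2⟩ | ⟨h1, h2⟩ | ⟨h1, h2⟩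
  · subst h1; exact Or.inl ⟨rfl, h2⟩
  · subst h1; exact Or.inr (Or.inr ⟨rfl, by rwa [add_comm]⟩)
  · subst h1; exact Or.inr (Or.inl ⟨rfl, by rwa [add_comm]⟩)

theorem PP_swap23 {a b c : ℕ} (h : PP (a, b, c)) : PP (a, c, b) := by
  rcases h with ⟨h1, h2⟩ | ⟨h1, h2⟩ | ⟨h1, h2⟩
  · subst h1; exact Or.inr (Or.inr ⟨rfl, h2⟩)
  · subst h1; exact Or.inr (Or.inl ⟨rfl, h2⟩)
  · subst h1; exact Or.inl ⟨rfl, h2⟩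

theorem Win_swap12 {a b c : ℕ} (h : Win a b c) : Win b a c := by
  obtain ⟨x, y, z, h1, h2⟩ := h
  refine ⟨y, x, z, ?_, PP_swap12 h2⟩
  rw [mem_moves] at *
  obtain ⟨k, hk, h' | h' | h' | h' | h' | h'⟩ := h1
  · exact ⟨k, hk, Or.inr (Or.inl ⟨by omega, by omega, by omega, by omega⟩)⟩
  · exact ⟨k, hk, Or.inl ⟨by omega, by omega, by omega, by omega⟩⟩
  · exact ⟨k, hk, Or.inr (Or.inr (Or.inr (Or.inr (Or.inl ⟨by omega, by omega, by omega, by omega⟩))))⟩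
  · exact ⟨k, hk, Or.inr (Or.inr (Or.inr (Or.inr (Or.inr (⟨by omega, by omega, by omega, by omega⟩)))))⟩
  · exact ⟨k, hk, Or.inr (Or.inr (Or.inl ⟨by omega, by omega, by omega, by omega⟩))⟩
  · exact ⟨k, hk, Or.inr (Or.inr (Or.inr (Or.inl ⟨by omega, by omega, by omega, by omega⟩)))⟩

theorem Win_swap23 {a b c : ℕ} (h : Win a b c) : Win a c b := by
  obtain ⟨x, y, z, h1, h2⟩ := h
  refine ⟨x, z, y, ?_, PP_swap23 h2⟩
  rw [mem_moves] at *
  obtain ⟨k, hk, h' | h' | h' | h' | h' | h'⟩ := h1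
  · exact ⟨k, hk, Or.inr (Or.inr (Or.inl ⟨by omega, by omega, by omega, by omega⟩))⟩
  · exact ⟨k, hk, Or.inr (Or.inr (Or.inr (Or.inl ⟨by omega, by omega, by omega, by omega⟩)))⟩
  · exact ⟨k, hk, Or.inl ⟨by omega, by omega, by omega, by omega⟩⟩
  · exact ⟨k, hk, Or.inr (Or.inl ⟨by omega, by omega, by omega, by omega⟩)⟩
  · exact ⟨k, hk, Or.inr (Or.inr (Or.inr (Or.inr (Or.inr (⟨by omega, by omega, by omega, by omega⟩)))))⟩
  · exact ⟨k, hk, Or.inr (Or.inr (Or.inr (Or.inr (Or.inl ⟨by omega, by omega, by omega, by omega⟩))))⟩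

theorem Win_sorted {a b c : ℕ} (hab : a ≤ b) (hbc : b ≤ c) (h : ¬ PP (a, b, c)) :
    Win a b c := by
  obtain ⟨p, rfl⟩ := Nat.exists_eq_add_of_le hab
  obtain ⟨r, rfl⟩ := Nat.exists_eq_add_of_le hbc
  -- moves equalising two piles; `d` is the distance of the middle pile to the reflected one
  by_cases hp : p = 0
  · subst hp
    have hn : ¬ Ev r := fun hr => h (Or.inl ⟨rfl, by
      have : a - (a + 0 + r) + (a + 0 + r - a) = r := by omega
      rwa [this]⟩)
    have hr0 : r ≠ 0 := fun h0 => hn (h0 ▸ ev_zero)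
    have hr : r % 2 = 0 := by
      by_contra h1; exact hn (ev_odd (by omega))
    obtain ⟨m, rfl⟩ : ∃ m, r = 2 * m := ⟨r / 2, by omega⟩
    have hm : Ev m := by
      by_contra h1; exact hn ((ev_double (by omega)).2 h1)
    refine ⟨a, a + m, a + m, mem_moves.2 ⟨m, by omega⟩, Or.inr (Or.inl ⟨rfl, ?_⟩)⟩
    have : a - (a + m) + (a + m - a) = m := by omega
    rwa [this]
  by_cases hr : r = 0
  · subst hr
    have hn : ¬ Ev p := fun hr => h (Or.inr (Or.inl ⟨rfl, by
      have : a - (a + p) + (a + p - a) = p := by omega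
      rwa [this]⟩))
    have hp2 : p % 2 = 0 := by
      by_contra h1; exact hn (ev_odd (by omega))
    obtain ⟨m, rfl⟩ : ∃ m, p = 2 * m := ⟨p / 2, by omega⟩
    have hm : Ev m := by
      by_contra h1; exact hn ((ev_double (by omega)).2 h1)
    refine ⟨a + m, a + m, a + 2 * m, mem_moves.2 ⟨m, by omega⟩, Or.inl ⟨rfl, ?_⟩⟩
    have : a + m - (a + 2 * m) + (a + 2 * m - (a + m)) = m := by omega
    rwa [this]
  by_cases hd : Ev ((p - r) + (r - p))
  · by_cases hpr : p ≤ r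
    · refine ⟨a + p, a + p, a + r, mem_moves.2 ⟨p, by omega⟩, Or.inl ⟨rfl, ?_⟩⟩
      have : a + p - (a + r) + (a + r - (a + p)) = (p - r) + (r - p) := by omega
      rwa [this]
    · refine ⟨a + r, a + p, a + p, mem_moves.2 ⟨r, by omega⟩, Or.inr (Or.inl ⟨rfl, ?_⟩)⟩
      have : a + r - (a + p) + (a + p - (a + r)) = (p - r) + (r - p) := by omega
      rwa [this]
  · have hd0 : (p - r) + (r - p) ≠ 0 := fun h0 => hd (h0 ▸ ev_zero)
    have hd2 : ((p - r) + (r - p)) % 2 = 0 := by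
      by_contra h1; exact hd (ev_odd (by omega))
    obtain ⟨m, hm⟩ : ∃ m, (p - r) + (r - p) = 2 * m := ⟨((p - r) + (r - p)) / 2, by omega⟩
    obtain ⟨s, hs⟩ : ∃ s, p + r = 2 * s := ⟨(p + r) / 2, by omega⟩
    rw [hm] at hd
    have hem : Ev m := by
      by_contra h1; exact hd ((ev_double (by omega)).2 h1)
    refine ⟨a + s, a + p, a + s, mem_moves.2 ⟨s, by omega⟩, Or.inr (Or.inr ⟨rfl, ?_⟩)⟩
    have : a + s - (a + p) + (a + p - (a + s)) = m := by omega
    rwa [this]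

theorem Win_of_not_PP {a b c : ℕ} (h : ¬ PP (a, b, c)) : Win a b c := by
  rcases le_total a b with h1 | h1 <;> rcases le_total b c with h2 | h2 <;>
    rcases le_total a c with h3 | h3
  · exact Win_sorted h1 h2 h
  · exact Win_sorted h1 h2 h
  · exact Win_swap23 (Win_sorted h3 h2 fun h' => h (PP_swap23 h'))
  · exact Win_swap23 (Win_swap12 (Win_sorted h3 h1 fun h' => h (PP_swap23 (PP_swap12 h'))))
  · exact Win_swap12 (Win_sorted h1 h3 fun h' => h (PP_swap12 h'))
  · exact Win_swap12 (Win_swap23 (Win_sorted h2 h3 fun h' => h (PP_swap12 (PP_swap23 h'))))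
  · exact Win_swap12 (Win_sorted h1 h3 fun h' => h (PP_swap12 h'))
  · exact Win_swap12 (Win_swap23 (Win_swap12 (Win_sorted h2 h1 fun h' =>
      h (PP_swap12 (PP_swap23 (PP_swap12 h'))))))

theorem G_eq_zero_iff (p : ℕ × ℕ × ℕ) : G p = 0 ↔ ∀ q ∈ moves p, G q ≠ 0 := by
  rw [G, mex, Nat.sInf_eq_zero]
  constructor
  · rintro (h | h)
    · intro q hq h0
      apply h
      simp only [Finset.mem_image, Finset.mem_attach, true_and, Subtype.exists]
      exact ⟨q, hq, h0⟩
    · exfalso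
      obtain ⟨n, hn⟩ := Infinite.exists_notMem_finset ((moves p).attach.image fun q => G q.1)
      have : n ∈ (∅ : Set ℕ) := h ▸ hn
      exact this
  · intro h
    left
    intro h'
    simp only [Finset.mem_image, Finset.mem_attach, true_and, Subtype.exists] at h'
    obtain ⟨q, hq, h0⟩ := h'
    exact h q hq h0

theorem G_zero_iff_PP (n : ℕ) : ∀ p, measure3 p < n → (G p = 0 ↔ PP p) := by
  induction n with
  | zero => intro p h; omega
  | succ n ih =>
    intro p hp
    rw [G_eq_zero_iff]
    constructor
    · intro h
      by_contra hn
      obtain ⟨a, b, c⟩ := p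
      obtain ⟨x, y, z, h1, h2⟩ := Win_of_not_PP hn
      have := measure3_lt_of_mem_moves h1
      exact h _ h1 ((ih _ (by omega)).2 h2)
    · intro h q hq h0
      have := measure3_lt_of_mem_moves hq
      exact PP_moves hq h ((ih q (by omega)).1 h0)

/-- For `a ≤ b`, `G(0,a,b) = 0` iff `a = b = 0`, or `a = 0`, `b > 0` and
`ν₂(b)` is even, or `a = b > 0` and `ν₂(b)` is even. -/
theorem grundy_zero_iff (a b : ℕ) (hab : a ≤ b) :
    G (0, a, b) = 0 ↔
      (a = 0 ∧ b = 0) ∨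
      (a = 0 ∧ 0 < b ∧ Even (padicValNat 2 b)) ∨
      (a = b ∧ 0 < b ∧ Even (padicValNat 2 b)) := by
  rw [G_zero_iff_PP _ _ (Nat.lt_succ_self _)]
  have e1 : 0 - b + (b - 0) = b := by omega
  have e2 : 0 - a + (a - 0) = a := by omega
  simp only [PP, e1, e2, Ev]
  constructor
  · rintro (⟨h1, h2⟩ | ⟨h1, h2⟩ | ⟨h1, h2⟩)
    · rcases Nat.eq_zero_or_pos b with hb | hb
      · exact Or.inl ⟨h1.symm, hb⟩
      · exact Or.inr (Or.inl ⟨h1.symm, hb, h2⟩)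
    · subst h1
      rcases Nat.eq_zero_or_pos a with hb | hb
      · exact Or.inl ⟨hb, hb⟩
      · exact Or.inr (Or.inr ⟨rfl, hb, h2⟩)
    · exact Or.inl ⟨by omega, by omega⟩
  · rintro (⟨h1, h2⟩ | ⟨h1, h2, h3⟩ | ⟨h1, h2, h3⟩)
    · subst h1; subst h2; exact Or.inl ⟨rfl, ev_zero⟩
    · exact Or.inl ⟨h1.symm, h3⟩
    · subst h1; exact Or.inr (Or.inl ⟨rfl, h3⟩)

end SharingNim
end

section
/- Define f(n) = 0 if G(0,0,n) = 0 and f(n) = 1 otherwise. Then for every natural number n ≥ 3: (1) if n is odd, then f(n) = 0; (2) if n mod 32 ∈ {4, 12, 16, 20, 28}, then f(n) = 0; (3) if n mod 32 ∈ {2, 6, 8, 10, 14, 18, 22, 24, 26, 30}, then f(n) = 1. -/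
namespace SharingNim

open Classical in
/-- The indicator of N-positions of the form `(0,0,n)`: `f n = 0` iff `(0,0,n)` is a
P-position, and `f n = 1` otherwise. -/
noncomputable def f (n : ℕ) : ℕ := if G (0, 0, n) = 0 then 0 else 1

/-- `pp d`: `d = 0` or the 2-adic valuation of `d` is even. -/
def pp (d : ℕ) : Prop := d = 0 ∨ Even (padicValNat 2 d)

theorem pp_zero : pp 0 := Or.inl rfl

theorem pp_odd {d : ℕ} (h : d % 2 = 1) : pp d := by
  right
  rw [padicValNat.eq_zero_of_not_dvd (by omega)]
  exact Even.zero

theorem pp_double {k : ℕ} (h : 1 ≤ k) : pp (2 * k) ↔ ¬ pp k := by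
  have h0 : k ≠ 0 := by omega
  have h2 : 2 * k ≠ 0 := by omega
  have e : padicValNat 2 (2 * k) = 1 + padicValNat 2 k := by
    rw [padicValNat.mul (by norm_num) h0, padicValNat.self (by norm_num)]
  simp only [pp, h0, h2, false_or, e]
  rw [add_comm, Nat.even_add_one]

/-- The candidate set of P-positions: two piles agree, and the difference to the third is `pp`. -/
def T (q : ℕ × ℕ × ℕ) : Prop :=
  (q.1 = q.2.1 ∧ pp ((q.1 - q.2.2) + (q.2.2 - q.1))) ∨
  (q.2.1 = q.2.2 ∧ pp ((q.1 - q.2.1) + (q.2.1 - q.1))) ∨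
  (q.1 = q.2.2 ∧ pp ((q.1 - q.2.1) + (q.2.1 - q.1)))

theorem mem_moves_iff {a b c : ℕ} {q : ℕ × ℕ × ℕ} : q ∈ moves (a, b, c) ↔ ∃ k, 1 ≤ k ∧
    ((2 * k ≤ b - a ∧ q = (a + k, b - k, c)) ∨ (2 * k ≤ a - b ∧ q = (a - k, b + k, c)) ∨
     (2 * k ≤ c - a ∧ q = (a + k, b, c - k)) ∨ (2 * k ≤ a - c ∧ q = (a - k, b, c + k)) ∨
     (2 * k ≤ c - b ∧ q = (a, b + k, c - k)) ∨ (2 * k ≤ b - c ∧ q = (a, b - k, c + k))) := by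
  simp only [moves, Finset.mem_union, Finset.mem_image, Finset.mem_Icc,
    Nat.le_div_iff_mul_le (show 0 < 2 by norm_num), mul_comm _ 2]
  constructor
  · rintro (((((⟨k, ⟨h1, h2⟩, rfl⟩ | ⟨k, ⟨h1, h2⟩, rfl⟩) | ⟨k, ⟨h1, h2⟩, rfl⟩) |
      ⟨k, ⟨h1, h2⟩, rfl⟩) | ⟨k, ⟨h1, h2⟩, rfl⟩) | ⟨k, ⟨h1, h2⟩, rfl⟩) <;>
    exact ⟨k, h1, by tauto⟩
  · rintro ⟨k, h1, (⟨h2, rfl⟩ | ⟨h2, rfl⟩ | ⟨h2, rfl⟩ | ⟨h2, rfl⟩ | ⟨h2, rfl⟩ | ⟨h2, rfl⟩)⟩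
    · exact Or.inl (Or.inl (Or.inl (Or.inl (Or.inl ⟨k, ⟨h1, h2⟩, rfl⟩))))
    · exact Or.inl (Or.inl (Or.inl (Or.inl (Or.inr ⟨k, ⟨h1, h2⟩, rfl⟩))))
    · exact Or.inl (Or.inl (Or.inl (Or.inr ⟨k, ⟨h1, h2⟩, rfl⟩)))
    · exact Or.inl (Or.inl (Or.inr ⟨k, ⟨h1, h2⟩, rfl⟩))
    · exact Or.inl (Or.inr ⟨k, ⟨h1, h2⟩, rfl⟩)
    · exact Or.inr ⟨k, ⟨h1, h2⟩, rfl⟩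

theorem pp_contra {k d e : ℕ} (hk : 1 ≤ k) (hd : d = 2 * k) (he : e = k) (h1 : pp d)
    (h2 : pp e) : False := by
  subst hd he
  exact (pp_double hk).1 h1 h2

theorem T_indep {p q : ℕ × ℕ × ℕ} (hp : T p) (hm : q ∈ moves p) : ¬ T q := by
  obtain ⟨a, b, c⟩ := p
  obtain ⟨k, h1, (⟨h2, rfl⟩ | ⟨h2, rfl⟩ | ⟨h2, rfl⟩ | ⟨h2, rfl⟩ | ⟨h2, rfl⟩ | ⟨h2, rfl⟩)⟩ :=
    mem_moves_iff.1 hm <;>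
  rintro (⟨e, t⟩ | ⟨e, t⟩ | ⟨e, t⟩) <;>
  rcases hp with (⟨e', t'⟩ | ⟨e', t'⟩ | ⟨e', t'⟩) <;>
  dsimp only at e t e' t' <;>
  first
  | omega
  | exact pp_contra h1 (by omega) (by omega) t' t

/-- There is a move into `T`. -/
def R (a b c : ℕ) : Prop := ∃ q ∈ moves (a, b, c), T q

theorem T_swap12 {a b c : ℕ} (h : T (a, b, c)) : T (b, a, c) := by
  rcases h with (⟨e, t⟩ | ⟨e, t⟩ | ⟨e, t⟩) <;> dsimp only at e t <;> subst e
  · exact Or.inl ⟨rfl, t⟩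
  · exact Or.inr (Or.inr ⟨rfl, by rwa [add_comm] at t⟩)
  · exact Or.inr (Or.inl ⟨rfl, by rwa [add_comm] at t⟩)

theorem T_swap23 {a b c : ℕ} (h : T (a, b, c)) : T (a, c, b) := by
  rcases h with (⟨e, t⟩ | ⟨e, t⟩ | ⟨e, t⟩) <;> dsimp only at e t <;> subst e
  · exact Or.inr (Or.inr ⟨rfl, t⟩)
  · exact Or.inr (Or.inl ⟨rfl, t⟩)
  · exact Or.inl ⟨rfl, t⟩

theorem R_swap12 {a b c : ℕ} (h : R a b c) : R b a c := by
  obtain ⟨q, hm, ht⟩ := h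
  obtain ⟨k, h1, (⟨h2, rfl⟩ | ⟨h2, rfl⟩ | ⟨h2, rfl⟩ | ⟨h2, rfl⟩ | ⟨h2, rfl⟩ | ⟨h2, rfl⟩)⟩ :=
    mem_moves_iff.1 hm
  · exact ⟨_, mem_moves_iff.2 ⟨k, h1, Or.inr (Or.inl ⟨h2, rfl⟩)⟩, T_swap12 ht⟩
  · exact ⟨_, mem_moves_iff.2 ⟨k, h1, Or.inl ⟨h2, rfl⟩⟩, T_swap12 ht⟩
  · exact ⟨_, mem_moves_iff.2 ⟨k, h1, Or.inr (Or.inr (Or.inr (Or.inr (Or.inl ⟨h2, rfl⟩))))⟩, T_swap12 ht⟩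
  · exact ⟨_, mem_moves_iff.2 ⟨k, h1, Or.inr (Or.inr (Or.inr (Or.inr (Or.inr (⟨h2, rfl⟩)))))⟩, T_swap12 ht⟩
  · exact ⟨_, mem_moves_iff.2 ⟨k, h1, Or.inr (Or.inr (Or.inl ⟨h2, rfl⟩))⟩, T_swap12 ht⟩
  · exact ⟨_, mem_moves_iff.2 ⟨k, h1, Or.inr (Or.inr (Or.inr (Or.inl ⟨h2, rfl⟩)))⟩, T_swap12 ht⟩

theorem R_swap23 {a b c : ℕ} (h : R a b c) : R a c b := by
  obtain ⟨q, hm, ht⟩ := h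
  obtain ⟨k, h1, (⟨h2, rfl⟩ | ⟨h2, rfl⟩ | ⟨h2, rfl⟩ | ⟨h2, rfl⟩ | ⟨h2, rfl⟩ | ⟨h2, rfl⟩)⟩ :=
    mem_moves_iff.1 hm
  · exact ⟨_, mem_moves_iff.2 ⟨k, h1, Or.inr (Or.inr (Or.inl ⟨h2, rfl⟩))⟩, T_swap23 ht⟩
  · exact ⟨_, mem_moves_iff.2 ⟨k, h1, Or.inr (Or.inr (Or.inr (Or.inl ⟨h2, rfl⟩)))⟩, T_swap23 ht⟩
  · exact ⟨_, mem_moves_iff.2 ⟨k, h1, Or.inl ⟨h2, rfl⟩⟩, T_swap23 ht⟩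
  · exact ⟨_, mem_moves_iff.2 ⟨k, h1, Or.inr (Or.inl ⟨h2, rfl⟩)⟩, T_swap23 ht⟩
  · exact ⟨_, mem_moves_iff.2 ⟨k, h1, Or.inr (Or.inr (Or.inr (Or.inr (Or.inr (⟨h2, rfl⟩)))))⟩, T_swap23 ht⟩
  · exact ⟨_, mem_moves_iff.2 ⟨k, h1, Or.inr (Or.inr (Or.inr (Or.inr (Or.inl ⟨h2, rfl⟩))))⟩, T_swap23 ht⟩

theorem half_of_not {d : ℕ} (h : ¬ pp d) : ∃ k, 1 ≤ k ∧ d = 2 * k ∧ pp k := by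
  have h0 : d ≠ 0 := fun e => h (e ▸ pp_zero)
  have h1 : d % 2 ≠ 1 := fun e => h (pp_odd e)
  refine ⟨d / 2, by omega, by omega, ?_⟩
  by_contra hc
  have := (pp_double (k := d / 2) (by omega)).2 hc
  rw [show 2 * (d / 2) = d by omega] at this
  exact h this

theorem T_of {a b c d : ℕ} (h : pp d) (h' : (a = b ∧ d = (a - c) + (c - a)) ∨
    (b = c ∧ d = (a - b) + (b - a)) ∨ (a = c ∧ d = (a - b) + (b - a))) : T (a, b, c) := by
  rcases h' with ⟨e, rfl⟩ | ⟨e, rfl⟩ | ⟨e, rfl⟩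
  · exact Or.inl ⟨e, h⟩
  · exact Or.inr (Or.inl ⟨e, h⟩)
  · exact Or.inr (Or.inr ⟨e, h⟩)

theorem R_sorted {a b c : ℕ} (hab : a ≤ b) (hbc : b ≤ c) (h : ¬ T (a, b, c)) : R a b c := by
  rcases Nat.eq_or_lt_of_le hab with e | hab'
  · subst e
    have hn : ¬ pp (c - a) := fun hp => h (T_of hp (by omega))
    obtain ⟨k, h1, h2, h3⟩ := half_of_not hn
    exact ⟨(a + k, a, c - k), mem_moves_iff.2 ⟨k, h1, by simp; omega⟩, T_of h3 (by omega)⟩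
  rcases Nat.eq_or_lt_of_le hbc with e | hbc'
  · subst e
    have hn : ¬ pp (b - a) := fun hp => h (T_of hp (by omega))
    obtain ⟨k, h1, h2, h3⟩ := half_of_not hn
    exact ⟨(a + k, b - k, b), mem_moves_iff.2 ⟨k, h1, by simp; omega⟩, T_of h3 (by omega)⟩
  by_cases hd : pp (((b - a) - (c - b)) + ((c - b) - (b - a)))
  · rcases le_total (b - a) (c - b) with hl | hl
    · exact ⟨(a + (b - a), b, c - (b - a)),
        mem_moves_iff.2 ⟨b - a, by omega, Or.inr (Or.inr (Or.inl ⟨by omega, rfl⟩))⟩,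
        T_of hd (by omega)⟩
    · exact ⟨(a + (c - b), b, c - (c - b)),
        mem_moves_iff.2 ⟨c - b, by omega, Or.inr (Or.inr (Or.inl ⟨by omega, rfl⟩))⟩,
        T_of hd (by omega)⟩
  · obtain ⟨k, h1, h2, h3⟩ := half_of_not hd
    exact ⟨(a + (c - a) / 2, b, c - (c - a) / 2),
      mem_moves_iff.2 ⟨(c - a) / 2, by omega, Or.inr (Or.inr (Or.inl ⟨by omega, rfl⟩))⟩,
      T_of h3 (by omega)⟩

theorem R_all {a b c : ℕ} (h : ¬ T (a, b, c)) : R a b c := by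
  rcases le_total a b with h1 | h1 <;> rcases le_total b c with h2 | h2 <;>
    rcases le_total a c with h3 | h3
  · exact R_sorted h1 h2 h
  · exact R_sorted h1 h2 h
  · exact R_swap23 (R_sorted h3 h2 fun t => h (T_swap23 t))
  · exact R_swap23 (R_swap12 (R_sorted h3 h1 fun t => h (T_swap23 (T_swap12 t))))
  · exact R_swap12 (R_sorted h1 h3 fun t => h (T_swap12 t))
  · exact R_swap12 (R_swap23 (R_sorted h2 h3 fun t => h (T_swap12 (T_swap23 t))))
  · exact R_swap12 (R_sorted h1 h3 fun t => h (T_swap12 t))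
  · exact R_swap12 (R_swap23 (R_swap12 (R_sorted h2 h1
      fun t => h (T_swap12 (T_swap23 (T_swap12 t))))))

theorem G_zero_iff_T (p : ℕ × ℕ × ℕ) : G p = 0 ↔ T p := by
  rw [G_eq_zero_iff]
  constructor
  · intro h
    by_contra ht
    obtain ⟨q, hm, hq⟩ := R_all (a := p.1) (b := p.2.1) (c := p.2.2) ht
    have := measure3_lt_of_mem_moves hm
    exact h q hm ((G_zero_iff_T q).2 hq)
  · intro ht q hm hq
    have := measure3_lt_of_mem_moves hm
    exact T_indep ht hm ((G_zero_iff_T q).1 hq)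
termination_by measure3 p

theorem G_iff_pp (n : ℕ) : G (0, 0, n) = 0 ↔ pp n := by
  rw [G_zero_iff_T]
  constructor
  · rintro (⟨e, t⟩ | ⟨e, t⟩ | ⟨e, t⟩) <;> dsimp only at e t
    · simpa using t
    · subst e; exact pp_zero
    · subst e; exact pp_zero
  · intro h
    exact T_of h (by omega)

theorem f_zero {n : ℕ} (h : pp n) : f n = 0 := if_pos ((G_iff_pp n).2 h)

theorem f_one {n : ℕ} (h : ¬ pp n) : f n = 1 := if_neg (fun e => h ((G_iff_pp n).1 e))

theorem pp_half {n : ℕ} (h : n % 2 = 0) (h0 : 1 ≤ n) : pp n ↔ ¬ pp (n / 2) := by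
  rw [← pp_double (by omega), show 2 * (n / 2) = n by omega]

/-- For `n ≥ 3`: if `n` is odd then `f n = 0`; if `n mod 32` is among
`{4,12,16,20,28}` then `f n = 0`; if `n mod 32` is among `{2,6,8,10,14,18,22,24,26,30}`
then `f n = 1`. -/
theorem f_mod32 (n : ℕ) (hn : 3 ≤ n) :
    (Odd n → f n = 0) ∧
    (n % 32 ∈ ({4, 12, 16, 20, 28} : Finset ℕ) → f n = 0) ∧
    (n % 32 ∈ ({2, 6, 8, 10, 14, 18, 22, 24, 26, 30} : Finset ℕ) → f n = 1) := by
  refine ⟨fun h => f_zero (pp_odd (Nat.odd_iff.1 h)), fun h => f_zero ?_, fun h => f_one ?_⟩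
  · simp only [Finset.mem_insert, Finset.mem_singleton] at h
    rw [pp_half (by omega) (by omega), pp_half (by omega) (by omega), not_not]
    by_cases h2 : n / 2 / 2 % 2 = 1
    · exact pp_odd h2
    · rw [pp_half (by omega) (by omega), pp_half (by omega) (by omega), not_not]
      exact pp_odd (by omega)
  · simp only [Finset.mem_insert, Finset.mem_singleton] at h
    rw [pp_half (by omega) (by omega), not_not]
    by_cases h2 : n / 2 % 2 = 1
    · exact pp_odd h2
    · rw [pp_half (by omega) (by omega), pp_half (by omega) (by omega), not_not]
      exact pp_odd (by omega)

end SharingNim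
end

section
/- There do not exist natural numbers n₀ and p ≥ 1 such that for all n ≥ n₀, the 2-adic valuation ν₂(n + p) is even if and only if ν₂(n) is even; that is, the indicator sequence of the set of positive integers with even 2-adic valuation is not ultimately periodic. -/
namespace SharingNim

/-- The indicator sequence of the set of positive integers with even
2-adic valuation is not ultimately periodic. -/
theorem even_padicValNat_not_ultimately_periodic :
    ¬ ∃ n₀ p : ℕ, 1 ≤ p ∧ ∀ n : ℕ, n₀ ≤ n → 0 < n →
      (Even (padicValNat 2 (n + p)) ↔ Even (padicValNat 2 n)) := by
  rintro ⟨n₀, p, hp, h⟩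
  have key := h (p * (4 * n₀ + 1)) (by nlinarith) (by positivity)
  have e : p * (4 * n₀ + 1) + p = p * (2 * (2 * n₀ + 1)) := by ring
  have h1 : padicValNat 2 (4 * n₀ + 1) = 0 :=
    padicValNat.eq_zero_of_not_dvd (by omega)
  have h2 : padicValNat 2 (2 * n₀ + 1) = 0 :=
    padicValNat.eq_zero_of_not_dvd (by omega)
  have h3 : padicValNat 2 2 = 1 := padicValNat.self (by norm_num)
  rw [e, padicValNat.mul (by omega) (by omega), padicValNat.mul (by omega) (by omega),
    padicValNat.mul (by omega) (by omega), h1, h2, h3] at key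
  simp only [add_zero, Nat.even_add_one] at key
  tauto

end SharingNim
end
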